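/- Let Ω ⊂ ℝ^N be a bounded open set, star-shaped with respect to the origin (i.e., x·ν(x) ≥ 0 on ∂Ω for the outer unit normal ν), let λ ≤ 0, and let u ∈ C²(Ω̄) solve -Δu = λu + |u|^{2*-2}u in Ω with u = 0 on ∂Ω. If moreover either λ < 0, or λ = 0 and Ω is strictly star-shaped (x·ν(x) > 0 on ∂Ω), then u ≡ 0. -/

import Mathlib

open scoped BigOperators

/-- The Laplacian on `ℝ^N` as the sum of second partial derivatives. -/
noncomputable def lap {N : ℕ} (f : EuclideanSpace ℝ (Fin N) → ℝ)
    (x : EuclideanSpace ℝ (Fin N)) : ℝ :=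
  ∑ i : Fin N, fderiv ℝ (fun y => fderiv ℝ f y (EuclideanSpace.single i 1)) x
    (EuclideanSpace.single i 1)

namespace Poho

open MeasureTheory Set Filter Topology
open scoped NNReal

/-- Euclidean space. -/
abbrev EN (N : ℕ) := EuclideanSpace ℝ (Fin N)

/-- Partial derivative. -/
noncomputable def dd {N : ℕ} (i : Fin N) (f : EN N → ℝ) (x : EN N) : ℝ :=
  fderiv ℝ f x (EuclideanSpace.single i 1)

lemma meas_dd {N : ℕ} (i : Fin N) (f : EN N → ℝ) : Measurable (dd i f) :=
  measurable_fderiv_apply_const ℝ f _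

lemma abs_dd_le {N : ℕ} (i : Fin N) (f : EN N → ℝ) (x : EN N) {C : ℝ}
    (h : ‖fderiv ℝ f x‖ ≤ C) : |dd i f x| ≤ C := by
  have := (fderiv ℝ f x).le_opNorm (EuclideanSpace.single i 1)
  simp only [EuclideanSpace.norm_single, norm_one, mul_one] at this
  exact this.trans h

lemma lip_dd_le {N : ℕ} (i : Fin N) {f : EN N → ℝ} {C : ℝ≥0} (h : LipschitzWith C f) (x : EN N) :
    |dd i f x| ≤ C := abs_dd_le i f x (norm_fderiv_le_of_lipschitz ℝ h)

/-- Integration by parts for Lipschitz functions. -/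
lemma ibp {N : ℕ} (i : Fin N) {f g : EN N → ℝ} {C D : ℝ≥0} (hf : LipschitzWith C f)
    (hg : LipschitzWith D g) (hgs : HasCompactSupport g) :
    ∫ x, dd i f x * g x = - ∫ x, f x * dd i g x := by
  have h := LipschitzWith.integral_lineDeriv_mul_eq (μ := (volume : Measure (EN N))) hf hg hgs
    (EuclideanSpace.single i 1)
  have h1 : ∫ x, dd i f x * g x = ∫ x, lineDeriv ℝ f x (EuclideanSpace.single i 1) * g x := by
    apply integral_congr_ae
    filter_upwards [hf.ae_differentiableAt (μ := volume)] with x hx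
    rw [hx.lineDeriv_eq_fderiv, dd]
  rw [h1, h, ← integral_neg]
  apply integral_congr_ae
  filter_upwards [hg.ae_differentiableAt (μ := volume)] with x hx
  rw [hx.lineDeriv_eq_fderiv, dd]
  simp [mul_comm]

/-- The integral of a derivative of a compactly supported Lipschitz function vanishes. -/
lemma integral_dd {N : ℕ} (i : Fin N) {g : EN N → ℝ} {D : ℝ≥0}
    (hg : LipschitzWith D g) (hgs : HasCompactSupport g) :
    ∫ x, dd i g x = 0 := by
  have h := ibp i (f := fun _ : EN N => (1:ℝ)) (LipschitzWith.const 1) hg hgs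
  have : ∀ x : EN N, dd i (fun _ : EN N => (1:ℝ)) x = 0 := by intro x; simp [dd]
  simp only [this, zero_mul, integral_zero, one_mul] at h
  linarith

/-- The derivative of a function vanishes almost everywhere on its zero set. -/
lemma ae_fderiv_zero {N : ℕ} [NeZero N] {f : EN N → ℝ} (hf : Continuous f) :
    ∀ᵐ x, f x = 0 → fderiv ℝ f x = 0 := by
  set s : Set (EN N) := {x | f x = 0} ∩ {x | DifferentiableAt ℝ f x} with hs
  have hsm : MeasurableSet s :=
    (isClosed_eq hf continuous_const).measurableSet.inter (measurableSet_of_differentiableAt ℝ f)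
  set v : EN N := EuclideanSpace.single 0 1
  have hv : ‖v‖ = 1 := by simp [v]
  have h := ApproximatesLinearOn.norm_fderiv_sub_le (volume : Measure (EN N))
    (f := fun x => f x • v) (s := s) (A := 0) (δ := 0)
    (by
      intro x hx y hy
      have h1 : f x = 0 := hx.1
      have h2 : f y = 0 := hy.1
      simp [h1, h2]) hsm (fun x => (fderiv ℝ f x).smulRight v)
    (by
      intro x hx
      exact ((hx.2 : DifferentiableAt ℝ f x).hasFDerivAt.smul_const v).hasFDerivWithinAt)
  rw [ae_restrict_iff' hsm] at h
  filter_upwards [h] with x hx h0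
  by_cases hd : DifferentiableAt ℝ f x
  · have := hx ⟨h0, hd⟩
    simp only [sub_zero, nonpos_iff_eq_zero, nnnorm_eq_zero] at this
    ext w
    have h2 := congrArg (fun L : EN N →L[ℝ] EN N => ‖L w‖) this
    simpa [norm_smul, hv] using h2
  · exact fderiv_zero_of_not_differentiableAt hd

/-- Zero extension lemma. -/
lemma lip_of_zero {N : ℕ} {Ω : Set (EN N)} (hΩ : IsOpen Ω) {H : EN N → ℝ} (hc : Continuous H)
    (hz : ∀ x, x ∉ Ω → H x = 0) {C : ℝ≥0}
    (hseg : ∀ x y, segment ℝ x y ⊆ Ω → |H x - H y| ≤ C * ‖x - y‖) :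
    LipschitzWith (2 * C) H := by
  have key : ∀ x y, ¬ segment ℝ x y ⊆ Ω → |H x| ≤ C * ‖x - y‖ := by
    intro x y hn
    by_cases hx : x ∈ Ω
    swap
    · rw [hz x hx]; simp; positivity
    let γ : ℝ → EN N := fun s => x + s • (y - x)
    have hγ : Continuous γ := by fun_prop
    let T : Set ℝ := Icc 0 1 ∩ γ ⁻¹' Ωᶜ
    have hT : IsCompact T := isCompact_Icc.inter_right (hΩ.isClosed_compl.preimage hγ)
    have hTn : T.Nonempty := by
      rw [segment_eq_image', not_subset] at hn
      obtain ⟨z, ⟨s, hs, rfl⟩, hz⟩ := hn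
      exact ⟨s, hs, hz⟩
    obtain ⟨s, hsT, hsl⟩ := hT.exists_isLeast hTn
    have hs0 : 0 < s := by
      rcases hsT.1.1.eq_or_lt with h | h
      · exfalso
        apply hsT.2
        simpa [γ, ← h] using hx
      · exact h
    have hlt : ∀ r ∈ Ico 0 s, |H x - H (γ r)| ≤ C * (r * ‖x - y‖) := by
      intro r hr
      have : segment ℝ x (γ r) ⊆ Ω := by
        rw [segment_eq_image']
        rintro z ⟨q, hq, rfl⟩
        by_contra hcon
        have : q * r ∈ T := by
          refine ⟨⟨mul_nonneg hq.1 hr.1, ?_⟩, ?_⟩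
          · nlinarith [hq.1, hq.2, hr.1, hr.2, hsT.1.2]
          · simpa [γ, smul_smul] using hcon
        have := hsl this
        nlinarith [hq.1, hq.2, hr.1, hr.2]
      have h := hseg x (γ r) this
      have e : ‖x - γ r‖ = r * ‖x - y‖ := by
        simp only [γ, sub_add_cancel_left, norm_neg, norm_smul, Real.norm_eq_abs, abs_of_nonneg hr.1]
        rw [norm_sub_rev]
      rwa [e] at h
    have hcl : |H x - H (γ s)| ≤ C * (s * ‖x - y‖) := by
      have hcl1 : IsClosed {r : ℝ | |H x - H (γ r)| ≤ C * (r * ‖x - y‖)} :=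
        isClosed_le (by fun_prop) (by fun_prop)
      have : s ∈ closure (Ico 0 s) := by
        rw [closure_Ico hs0.ne]; exact ⟨hs0.le, le_rfl⟩
      exact closure_minimal hlt hcl1 this
    rw [hz (γ s) hsT.2, sub_zero] at hcl
    refine hcl.trans ?_
    gcongr
    nlinarith [norm_nonneg (x - y), hsT.1.2]
  refine LipschitzWith.of_dist_le_mul fun x y => ?_
  rw [Real.dist_eq, dist_eq_norm]
  push_cast
  by_cases h : segment ℝ x y ⊆ Ω
  · have := hseg x y h
    have h0 : 0 ≤ C * ‖x - y‖ := by positivity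
    linarith
  · have h1 := key x y h
    have h2 := key y x (by rwa [segment_symm])
    rw [norm_sub_rev] at h2
    have := abs_sub (H x) (H y)
    linarith

/-- Segmentwise Lipschitz bound from a derivative bound. -/
lemma seg_of_fderiv {N : ℕ} {Ω : Set (EN N)} {H : EN N → ℝ}
    (hd : ∀ x ∈ Ω, DifferentiableAt ℝ H x) {C : ℝ}
    (hb : ∀ x ∈ Ω, ‖fderiv ℝ H x‖ ≤ C) (x y : EN N) (hs : segment ℝ x y ⊆ Ω) :
    |H x - H y| ≤ C * ‖x - y‖ := by
  have := (convex_segment (𝕜 := ℝ) x y).norm_image_sub_le_of_norm_fderiv_le (f := H) (C := C)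
    (fun z hz => hd z (hs hz)) (fun z hz => hb z (hs hz)) (right_mem_segment ℝ x y)
    (left_mem_segment ℝ x y)
  simpa using this

/-- Bounded measurable functions vanishing off a ball are integrable. -/
lemma integrable_bdd {N : ℕ} {h : EN N → ℝ} (hm : AEStronglyMeasurable h volume) {C R : ℝ}
    (hb : ∀ x, |h x| ≤ C) (hz : ∀ x, R < ‖x‖ → h x = 0) : Integrable h := by
  have h1 : IntegrableOn h (Metric.closedBall 0 R) :=
    Measure.integrableOn_of_bounded (M := C) (measure_closedBall_lt_top).ne hm
      (Eventually.of_forall hb)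
  refine h1.integrable_of_forall_notMem_eq_zero fun x hx => hz x ?_
  simpa using hx

/-- derivatives vanish off the ball too. -/
lemma dd_zero {N : ℕ} (i : Fin N) {h : EN N → ℝ} {R : ℝ} (hz : ∀ x, R < ‖x‖ → h x = 0) (x : EN N)
    (hx : R < ‖x‖) : dd i h x = 0 := by
  have : h =ᶠ[𝓝 x] fun _ => 0 := by
    filter_upwards [(isOpen_lt continuous_const continuous_norm).mem_nhds hx] with y hy
    exact hz y hy
  rw [dd, this.fderiv_eq]; simp

lemma hcs {N : ℕ} {h : EN N → ℝ} {R : ℝ} (hz : ∀ x, R < ‖x‖ → h x = 0) : HasCompactSupport h :=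
  HasCompactSupport.intro (isCompact_closedBall 0 R) fun x hx => hz x (by simpa using hx)


/-- Local consequences of `C²` regularity up to the boundary. -/
lemma reg_local {N : ℕ} {Ω : Set (EN N)} (hΩ : IsOpen Ω) {u : EN N → ℝ}
    (hu : ContDiffOn ℝ 2 u (closure Ω)) (p : EN N) (hp : p ∈ closure Ω) :
    (∃ a, Tendsto (fderiv ℝ u) (𝓝[Ω] p) (𝓝 a)) ∧
    ∃ b, Tendsto (fderiv ℝ (fderiv ℝ u)) (𝓝[Ω] p) (𝓝 b) := by
  have h := hu p hp
  have h2 : (2 : WithTop ℕ∞) = 1 + 1 := by norm_num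
  have h1 : (1 : WithTop ℕ∞) = 0 + 1 := by norm_num
  rw [h2, contDiffWithinAt_succ_iff_hasFDerivWithinAt (by simp)] at h
  obtain ⟨v, hv, -, f', hf', hc⟩ := h
  rw [insert_eq_of_mem hp] at hv
  have hc0 : ContinuousWithinAt f' v p := hc.continuousWithinAt
  rw [h1, contDiffWithinAt_succ_iff_hasFDerivWithinAt (by simp)] at hc
  obtain ⟨v', hv', -, f'', hf'', hc'⟩ := hc
  have hpv : p ∈ v := mem_of_mem_nhdsWithin hp hv
  rw [insert_eq_of_mem hpv] at hv'
  have hc1 : ContinuousWithinAt f'' v' p := hc'.continuousWithinAt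
  obtain ⟨W, hWo, hpW, hW⟩ := mem_nhdsWithin.1 hv
  obtain ⟨W', hWo', hpW', hW'⟩ := mem_nhdsWithin.1 hv'
  have e1 : ∀ x ∈ W ∩ Ω, fderiv ℝ u x = f' x := by
    intro x hx
    have hn : v ∈ 𝓝 x := mem_of_superset ((hWo.inter hΩ).mem_nhds hx)
      (fun y hy => hW ⟨hy.1, subset_closure hy.2⟩)
    exact ((hf' x (mem_of_mem_nhds hn)).hasFDerivAt hn).fderiv
  have e2 : ∀ x ∈ (W ∩ W') ∩ Ω, fderiv ℝ (fderiv ℝ u) x = f'' x := by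
    intro x hx
    have hn : v' ∈ 𝓝 x := mem_of_superset (((hWo.inter hWo').inter hΩ).mem_nhds hx)
      (fun y hy => hW' ⟨hy.1.2, hW ⟨hy.1.1, subset_closure hy.2⟩⟩)
    have h3 := ((hf'' x (mem_of_mem_nhds hn)).hasFDerivAt hn).fderiv
    rw [← h3]
    apply Filter.EventuallyEq.fderiv_eq
    filter_upwards [(hWo.inter hΩ).mem_nhds ⟨hx.1.1, hx.2⟩] with y hy using e1 y hy
  have n1 : W ∩ Ω ∈ 𝓝[Ω] p := inter_mem (mem_nhdsWithin_of_mem_nhds (hWo.mem_nhds hpW)) self_mem_nhdsWithin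
  have n2 : (W ∩ W') ∩ Ω ∈ 𝓝[Ω] p := 
    inter_mem (mem_nhdsWithin_of_mem_nhds ((hWo.inter hWo').mem_nhds ⟨hpW, hpW'⟩)) self_mem_nhdsWithin
  have l1 : 𝓝[Ω] p ≤ 𝓝[v] p := by
    apply nhdsWithin_le_of_mem
    exact nhdsWithin_mono _ subset_closure hv
  have l2 : 𝓝[Ω] p ≤ 𝓝[v'] p := by
    apply nhdsWithin_le_of_mem
    exact l1 hv'
  refine ⟨⟨f' p, ?_⟩, ⟨f'' p, ?_⟩⟩
  · refine (hc0.tendsto.mono_left l1).congr' ?_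
    filter_upwards [n1] with x hx using (e1 x hx).symm
  · refine (hc1.tendsto.mono_left l2).congr' ?_
    filter_upwards [n2] with x hx using (e2 x hx).symm

/-- A function with limits along `Ω` at all points of the compact closure is bounded. -/
lemma bdd_of_lim {N : ℕ} {F : Type*} [NormedAddCommGroup F] {Ω : Set (EN N)}
    (hb : Bornology.IsBounded Ω) {g : EN N → F}
    (h : ∀ p ∈ closure Ω, ∃ a, Tendsto g (𝓝[Ω] p) (𝓝 a)) : ∃ M, ∀ x ∈ Ω, ‖g x‖ ≤ M := by
  have hcomp : IsCompact (closure Ω) := hb.isCompact_closure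
  have := hcomp.induction_on (p := fun s => ∃ M, ∀ x ∈ s ∩ Ω, ‖g x‖ ≤ M)
    ⟨0, by simp⟩
    (fun s t hst ⟨M, hM⟩ => ⟨M, fun x hx => hM x ⟨hst hx.1, hx.2⟩⟩)
    (fun s t ⟨M, hM⟩ ⟨M', hM'⟩ => ⟨max M M', fun x hx => by
      rcases hx.1 with h | h
      · exact (hM x ⟨h, hx.2⟩).trans (le_max_left _ _)
      · exact (hM' x ⟨h, hx.2⟩).trans (le_max_right _ _)⟩)
    (by
      intro p hp
      obtain ⟨a, ha⟩ := h p hp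
      have h1 : ∀ᶠ x in 𝓝[Ω] p, ‖g x‖ < ‖a‖ + 1 :=
        ha.norm.eventually_lt_const (by linarith)
      obtain ⟨W, hWo, hpW, hW⟩ := mem_nhdsWithin.1 h1
      refine ⟨W, mem_nhdsWithin_of_mem_nhds (hWo.mem_nhds hpW), ‖a‖ + 1, fun x hx => ?_⟩
      exact (hW hx : ‖g x‖ < ‖a‖ + 1).le)
  obtain ⟨M, hM⟩ := this
  exact ⟨M, fun x hx => hM x ⟨subset_closure hx, hx⟩⟩

/-- Data extracted from the hypotheses of the theorem: a globally Lipschitz function `U`,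
zero off `Ω`, `C²` in `Ω` with bounded derivatives. -/
structure Data {N : ℕ} (Ω : Set (EN N)) (U : EN N → ℝ) (R M B : ℝ) (L : ℝ≥0) : Prop where
  op : IsOpen Ω
  bd : ∀ x ∈ Ω, ‖x‖ ≤ R
  lip : LipschitzWith L U
  zero : ∀ x, x ∉ Ω → U x = 0
  reg : ContDiffOn ℝ 2 U Ω
  d1 : ∀ x ∈ Ω, ‖fderiv ℝ U x‖ ≤ M
  d2 : ∀ x ∈ Ω, ‖fderiv ℝ (fderiv ℝ U) x‖ ≤ M
  Mpos : 0 ≤ M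
  Rpos : 0 < R
  ub : ∀ x, |U x| ≤ B
  lim : ∀ p ∈ frontier Ω, ∃ a, Tendsto (fderiv ℝ U) (𝓝[Ω] p) (𝓝 a)

lemma exists_data {N : ℕ} {Ω : Set (EN N)} (hΩ : IsOpen Ω) (hb : Bornology.IsBounded Ω)
    {u : EN N → ℝ} (hu : ContDiffOn ℝ 2 u (closure Ω)) (hubd : ∀ x ∈ frontier Ω, u x = 0) :
    ∃ R M B L, Data Ω (Ω.indicator u) R M B L := by
  obtain ⟨M1, hM1⟩ := bdd_of_lim hb (fun p hp => (reg_local hΩ hu p hp).1)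
  obtain ⟨M2, hM2⟩ := bdd_of_lim hb (g := fderiv ℝ (fderiv ℝ u)) (fun p hp => (reg_local hΩ hu p hp).2)
  obtain ⟨R, hRpos, hR⟩ := hb.exists_pos_norm_le
  have hcont : Continuous (Ω.indicator u) := by
    refine continuous_indicator hubd hu.continuousOn
  set U := Ω.indicator u with hU
  have hev : ∀ x ∈ Ω, U =ᶠ[𝓝 x] u := fun x hx => by
    filter_upwards [hΩ.mem_nhds hx] with y hy
    simp [hU, hy]
  have hfd : ∀ x ∈ Ω, fderiv ℝ U x = fderiv ℝ u x := fun x hx => (hev x hx).fderiv_eq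
  have hfd2 : ∀ x ∈ Ω, fderiv ℝ (fderiv ℝ U) x = fderiv ℝ (fderiv ℝ u) x := fun x hx =>
    (hev x hx).fderiv.fderiv_eq
  have hreg : ContDiffOn ℝ 2 U Ω :=
    (hu.mono subset_closure).congr fun x hx => by simp [hU, hx]
  set M : ℝ := max (max M1 M2) 0
  have hd1 : ∀ x ∈ Ω, ‖fderiv ℝ U x‖ ≤ M := fun x hx => by
    rw [hfd x hx]; exact (hM1 x hx).trans (by simp [M])
  have hz : ∀ x, x ∉ Ω → U x = 0 := fun x hx => by simp [hU, hx]
  have hlip := lip_of_zero hΩ hcont hz (C := M.toNNReal) (by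
    rw [Real.coe_toNNReal M (le_max_right _ _)]
    refine seg_of_fderiv (fun x hx => ?_) hd1
    exact (hreg.contDiffAt (hΩ.mem_nhds hx)).differentiableAt (by norm_num))
  obtain ⟨B, hB⟩ := hcont.bounded_above_of_compact_support
    (hcs (R := R) fun x hx => hz x fun h => by linarith [hR x h])
  refine ⟨R, M, B, _, hΩ, hR, hlip, hz, hreg, hd1, fun x hx => ?_, le_max_right _ _, hRpos, hB,
    fun p hp => ?_⟩
  · rw [hfd2 x hx]; exact (hM2 x hx).trans (by simp [M])
  · obtain ⟨a, ha⟩ := (reg_local hΩ hu p (frontier_subset_closure hp)).1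
    refine ⟨a, ha.congr' ?_⟩
    filter_upwards [self_mem_nhdsWithin] with x hx using (hfd x hx).symm

namespace Data

variable {N : ℕ} {Ω : Set (EN N)} {U : EN N → ℝ} {R M B : ℝ} {L : ℝ≥0}

lemma cda (D : Data Ω U R M B L) {x : EN N} (hx : x ∈ Ω) : ContDiffAt ℝ 2 U x :=
  D.reg.contDiffAt (D.op.mem_nhds hx)

lemma diff (D : Data Ω U R M B L) {x : EN N} (hx : x ∈ Ω) : DifferentiableAt ℝ U x :=
  (D.cda hx).differentiableAt (by norm_num)

lemma diff2 (D : Data Ω U R M B L) {x : EN N} (hx : x ∈ Ω) :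
    DifferentiableAt ℝ (fderiv ℝ U) x :=
  ((D.cda hx).fderiv_right (m := 1) (by norm_num)).differentiableAt (by norm_num)

lemma hasF (D : Data Ω U R M B L) (i : Fin N) {x : EN N} (hx : x ∈ Ω) :
    HasFDerivAt (dd i U) ((fderiv ℝ (fderiv ℝ U) x).flip (EuclideanSpace.single i 1)) x := by
  have := (D.diff2 hx).hasFDerivAt.clm_apply (hasFDerivAt_const (EuclideanSpace.single i (1:ℝ)) x)
  convert! this using 1
  ext v
  simp

lemma dd_diff (D : Data Ω U R M B L) (i : Fin N) {x : EN N} (hx : x ∈ Ω) :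
    DifferentiableAt ℝ (dd i U) x := (D.hasF i hx).differentiableAt

lemma dd_bd (D : Data Ω U R M B L) (i : Fin N) {x : EN N} (hx : x ∈ Ω) :
    ‖fderiv ℝ (dd i U) x‖ ≤ M := by
  rw [(D.hasF i hx).fderiv]
  have := (fderiv ℝ (fderiv ℝ U) x).flip.le_opNorm (EuclideanSpace.single i 1)
  rw [ContinuousLinearMap.opNorm_flip] at this
  simp only [PiLp.norm_single, norm_one, mul_one] at this
  exact this.trans (D.d2 x hx)

lemma symm2 (D : Data Ω U R M B L) (i j : Fin N) {x : EN N} (hx : x ∈ Ω) :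
    dd j (dd i U) x = dd i (dd j U) x := by
  rw [dd, dd, (D.hasF i hx).fderiv, (D.hasF j hx).fderiv]
  have := (D.cda hx).isSymmSndFDerivAt (by simp)
  simpa using this _ _

lemma zero_ball (D : Data Ω U R M B L) {φ : EN N → ℝ} (hφ : ∀ x, x ∉ Ω → φ x = 0) (x : EN N)
    (hx : R < ‖x‖) : φ x = 0 := hφ x fun h => by linarith [D.bd x h]

/-- Weak formulation, tested with Lipschitz functions vanishing off `Ω`. -/
lemma weak (D : Data Ω U R M B L) [NeZero N] {f : EN N → ℝ}
    (hf : ∀ x ∈ Ω, - ∑ i, dd i (dd i U) x = f x) {φ : EN N → ℝ} {K : ℝ≥0} (hφ : LipschitzWith K φ)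
    (hφ0 : ∀ x, x ∉ Ω → φ x = 0) :
    ∫ x, ∑ i, dd i U x * dd i φ x = ∫ x, f x * φ x := by
  obtain ⟨Q, hQ⟩ := hφ.continuous.bounded_above_of_compact_support (hcs (D.zero_ball hφ0))
  have hQ0 : 0 ≤ Q := (norm_nonneg _).trans (hQ 0)
  have key : ∀ i, ∃ C : ℝ≥0, LipschitzWith C (fun x => φ x * dd i U x) := by
    intro i
    have hC : 0 ≤ Q * M + L * K := by have := D.Mpos; positivity
    refine ⟨_, lip_of_zero D.op ?_ ?_ (C := (Q * M + L * K).toNNReal) ?_⟩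
    · rw [continuous_iff_continuousAt]
      intro x
      by_cases hx : x ∈ Ω
      · exact hφ.continuous.continuousAt.mul (D.dd_diff i hx).continuousAt
      · rw [ContinuousAt, hφ0 x hx, zero_mul]
        have h1 : Tendsto (fun y => L * |φ y|) (𝓝 x) (𝓝 0) := by
          have : Continuous fun y => L * |φ y| := by
            have := hφ.continuous; fun_prop
          simpa [hφ0 x hx] using this.tendsto x
        refine squeeze_zero_norm (fun y => ?_) h1
        rw [norm_mul, mul_comm, Real.norm_eq_abs, Real.norm_eq_abs]
        gcongr
        exact lip_dd_le i D.lip y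
    · intro x hx; simp [hφ0 x hx]
    · intro x y hs
      have h1 := seg_of_fderiv (fun x hx => D.dd_diff i hx) (fun x hx => D.dd_bd i hx) x y hs
      have h2 : |φ x - φ y| ≤ K * ‖x - y‖ := by
        simpa [Real.dist_eq, dist_eq_norm] using hφ.dist_le_mul x y
      have h3 := hQ x
      have h4 := lip_dd_le i D.lip y
      rw [Real.norm_eq_abs] at h3
      have e : φ x * dd i U x - φ y * dd i U y
        = φ x * (dd i U x - dd i U y) + dd i U y * (φ x - φ y) := by ring
      rw [e]
      refine (abs_add_le _ _).trans ?_
      rw [abs_mul, abs_mul]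
      have h5 := mul_le_mul h3 h1 (abs_nonneg _) hQ0
      have h6 := mul_le_mul h4 h2 (abs_nonneg _) L.2
      rw [Real.coe_toNNReal _ hC]
      linarith
  have hG0 : ∀ i x, R < ‖x‖ → φ x * dd i U x = 0 := fun i x hx => by
    rw [D.zero_ball hφ0 x hx, zero_mul]
  have hGi : ∀ i, Integrable (dd i (fun x => φ x * dd i U x)) := fun i => by
    obtain ⟨C, hC⟩ := key i
    exact integrable_bdd (meas_dd _ _).aestronglyMeasurable (lip_dd_le i hC)
      (dd_zero i (hG0 i))
  have hpi : ∀ i, Integrable (fun x => dd i U x * dd i φ x) := fun i => by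
    refine integrable_bdd (C := L * K) (R := R)
      ((meas_dd _ _).mul (meas_dd _ _)).aestronglyMeasurable (fun x => ?_)
      (fun x hx => by rw [dd_zero i (D.zero_ball hφ0) x hx, mul_zero])
    rw [abs_mul]
    exact mul_le_mul (lip_dd_le i D.lip x) (lip_dd_le i hφ x) (abs_nonneg _) L.2
  have hae : ∀ i, ∀ᵐ x, (dd i (fun x => φ x * dd i U x)) x
      = dd i U x * dd i φ x + φ x * dd i (dd i U) x := by
    intro i
    obtain ⟨C, hC⟩ := key i
    filter_upwards [ae_fderiv_zero hC.continuous, ae_fderiv_zero hφ.continuous,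
      hφ.ae_differentiableAt (μ := volume)] with x h1 h2 h3
    by_cases hx : x ∈ Ω
    · have := (h3.hasFDerivAt.fun_mul (D.dd_diff i hx).hasFDerivAt).fderiv
      rw [dd, this]
      simp [dd]
      ring
    · have h0 := hφ0 x hx
      rw [dd, h1 (by rw [h0, zero_mul]), dd, dd, h2 h0, h0]
      simp
  have h : ∫ x, f x * φ x
      = ∫ x, ((∑ i, dd i U x * dd i φ x) - ∑ i, dd i (fun x => φ x * dd i U x) x) := by
    apply integral_congr_ae
    filter_upwards [ae_all_iff.2 hae] with x hx
    simp only [hx]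
    by_cases hxΩ : x ∈ Ω
    · rw [← hf x hxΩ, Finset.sum_add_distrib, ← Finset.mul_sum]; ring
    · simp [hφ0 x hxΩ]
  rw [h, integral_sub (integrable_finsetSum _ fun i _ => hpi i)
    (integrable_finsetSum _ fun i _ => hGi i), integral_finsetSum (s := Finset.univ) (hf := fun i _ => hGi i)]
  have : ∀ i, ∫ x, dd i (fun x => φ x * dd i U x) x = 0 := fun i => by
    obtain ⟨C, hC⟩ := key i
    exact integral_dd i hC (hcs (hG0 i))
  simp [this]

end Data

lemma clm_sum {N : ℕ} (T : EN N →L[ℝ] ℝ) (x : EN N) :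
    T x = ∑ i, x i * T (EuclideanSpace.single i 1) := by
  conv_lhs => rw [← (EuclideanSpace.basisFun (Fin N) ℝ).sum_repr x]
  simp [map_sum]

lemma abs_coord_le {N : ℕ} (i : Fin N) (x : EN N) : |x i| ≤ ‖x‖ := PiLp.norm_apply_le x i

lemma int_dd_mul {N : ℕ} (i j : Fin N) {φ ψ : EN N → ℝ} {K L : ℝ≥0} {R : ℝ}
    (hφ : LipschitzWith K φ) (hψ : LipschitzWith L ψ) (hz : ∀ x, R < ‖x‖ → φ x = 0) :
    Integrable (fun x => dd i φ x * dd j ψ x) := by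
  refine integrable_bdd (C := K * L) (R := R)
      ((meas_dd _ _).mul (meas_dd _ _)).aestronglyMeasurable (fun x => ?_)
      (fun x hx => by rw [dd_zero i hz x hx, zero_mul])
  rw [abs_mul]
  exact mul_le_mul (lip_dd_le i hφ x) (lip_dd_le j hψ x) (abs_nonneg _) K.2

namespace Data

variable {N : ℕ} {Ω : Set (EN N)} {U : EN N → ℝ} {R M B : ℝ} {L : ℝ≥0}

lemma dil_lip (D : Data Ω U R M B L) (t : ℝ) :
    LipschitzWith (L * ‖t‖₊) (fun x => U (t • x)) :=
  D.lip.comp (lipschitzWith_smul t)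

lemma dil_zero (D : Data Ω U R M B L) (hst : ∀ t : ℝ, 1 ≤ t → ∀ x, t • x ∈ Ω → x ∈ Ω)
    {t : ℝ} (ht : 1 ≤ t) (x : EN N) (hx : x ∉ Ω) : U (t • x) = 0 :=
  D.zero _ fun h => hx (hst t ht x h)

lemma k_eq (D : Data Ω U R M B L) [NeZero N] {f : ℝ → ℝ}
    (hf : ∀ x ∈ Ω, - ∑ i, dd i (dd i U) x = f (U x))
    (hst : ∀ t : ℝ, 1 ≤ t → ∀ x, t • x ∈ Ω → x ∈ Ω) {t : ℝ} (ht : 1 ≤ t) :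
    ∫ x, ∑ i, (dd i U x - dd i (fun x => U (t • x)) x) ^ 2 =
      (∫ x, f (U x) * U x) * (1 + t ^ 2 * (t ^ N)⁻¹) - 2 * ∫ x, f (U x) * U (t • x) := by
  have hz := D.zero_ball D.zero
  have hz' := D.zero_ball (D.dil_zero hst ht)
  have hA := D.weak hf D.lip D.zero
  have hD := D.weak hf (D.dil_lip t) (D.dil_zero hst ht)
  have hV : ∫ x, ∑ i, dd i (fun x => U (t • x)) x * dd i (fun x => U (t • x)) x
      = (∫ x, f (U x) * U x) * (t ^ 2 * (t ^ N)⁻¹) := by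
    have e : ∀ x, ∑ i, dd i (fun x => U (t • x)) x * dd i (fun x => U (t • x)) x
        = (fun y => t ^ 2 * ∑ i, dd i U y * dd i U y) (t • x) := by
      intro x
      simp only [Finset.mul_sum]
      refine Finset.sum_congr rfl fun i _ => ?_
      have : dd i (fun x => U (t • x)) x = t * dd i U (t • x) := by
        rw [dd, fderiv_comp_smul]; simp [dd]
      rw [this]; ring
    rw [integral_congr_ae (Eventually.of_forall e)]
    rw [Measure.integral_comp_smul volume (fun y => t ^ 2 * ∑ i, dd i U y * dd i U y) t, integral_const_mul, hA]
    simp only [finrank_euclideanSpace, Fintype.card_fin, smul_eq_mul]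
    rw [abs_of_nonneg (by positivity)]
    ring
  have e : ∀ x, ∑ i, (dd i U x - dd i (fun x => U (t • x)) x) ^ 2
      = ∑ i, dd i U x * dd i U x
        + ∑ i, dd i (fun x => U (t • x)) x * dd i (fun x => U (t • x)) x
        - 2 * ∑ i, dd i U x * dd i (fun x => U (t • x)) x := by
    intro x
    rw [Finset.mul_sum, ← Finset.sum_add_distrib, ← Finset.sum_sub_distrib]
    exact Finset.sum_congr rfl fun i _ => by ring
  simp_rw [e]
  have i1 : Integrable fun x => ∑ i, dd i U x * dd i U x :=
    integrable_finsetSum _ fun i _ => int_dd_mul i i D.lip D.lip hz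
  have i2 : Integrable fun x => ∑ i, dd i (fun x => U (t • x)) x * dd i (fun x => U (t • x)) x :=
    integrable_finsetSum _ fun i _ => int_dd_mul i i (D.dil_lip t) (D.dil_lip t) hz'
  have i3 : Integrable fun x => ∑ i, dd i U x * dd i (fun x => U (t • x)) x :=
    integrable_finsetSum _ fun i _ => int_dd_mul i i D.lip (D.dil_lip t) hz
  rw [integral_sub (by exact i1.add i2) (i3.const_mul 2), integral_add i1 i2, integral_const_mul, hA, hD, hV]
  ring

lemma comp_lip (D : Data Ω U R M B L) {f F : ℝ → ℝ} (hfc : Continuous f)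
    (hF : ∀ s, HasDerivAt F (f s) s) : ∃ C : ℝ≥0, LipschitzWith C (fun x => F (U x)) := by
  obtain ⟨C, hC⟩ := isCompact_Icc.exists_bound_of_continuousOn (s := Icc (-B) B) hfc.continuousOn
  have h1 : LipschitzOnWith C.toNNReal F (Icc (-B) B) := by
    refine (convex_Icc _ _).lipschitzOnWith_of_nnnorm_hasDerivWithin_le
      (fun x hx => (hF x).hasDerivWithinAt) (fun x hx => ?_)
    rw [← NNReal.coe_le_coe, coe_nnnorm]
    exact (hC x hx).trans (Real.le_coe_toNNReal C)
  refine ⟨C.toNNReal * L, ?_⟩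
  have := h1.comp (D.lip.lipschitzOnWith (s := univ)) (fun x _ => abs_le.1 (D.ub x))
  exact lipschitzOnWith_univ.1 this

lemma D_deriv (D : Data Ω U R M B L) {f F : ℝ → ℝ} (hfc : Continuous f) (hf0 : f 0 = 0)
    (hF : ∀ s, HasDerivAt F (f s) s) (hF0 : F 0 = 0) :
    HasDerivAt (fun t : ℝ => ∫ x, f (U x) * U (t • x)) (- (N * ∫ x, F (U x))) 1 := by
  obtain ⟨C, hC⟩ := D.comp_lip hfc hF
  have hUc := D.lip.continuous
  have hz := D.zero_ball D.zero
  have hHz : ∀ x, R < ‖x‖ → F (U x) = 0 := fun x hx => by rw [hz x hx, hF0]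
  obtain ⟨Q, hQ⟩ := (hfc.comp hUc).bounded_above_of_compact_support
    (hcs (R := R) fun x hx => by simp [hz x hx, hf0])
  have hQ0 : 0 ≤ Q := (norm_nonneg _).trans (hQ 0)
  have hUm : Measurable (fun x : EN N => fderiv ℝ U x x) := by
    have : (fun x : EN N => fderiv ℝ U x x) = fun x => ∑ i, x i * dd i U x := by
      ext x
      exact clm_sum _ x
    rw [this]
    refine Finset.measurable_sum _ fun i _ => ?_
    exact Measurable.mul (by fun_prop) (meas_dd _ _)
  have h := hasDerivAt_integral_of_dominated_loc_of_lip (μ := (volume : Measure (EN N)))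
    (F := fun (t : ℝ) x => f (U x) * U (t • x)) (x₀ := (1:ℝ)) (s := univ)
    (F' := fun x => f (U x) * fderiv ℝ U x x)
    (bound := fun x => |f (U x)| * (L * ‖x‖)) univ_mem
    (Eventually.of_forall fun t => by
      apply Continuous.aestronglyMeasurable; fun_prop)
    (by
      apply Continuous.integrable_of_hasCompactSupport
      · fun_prop
      · exact hcs (R := R) fun x hx => by simp [hz x hx, hf0])
    (((hfc.comp hUc).measurable.mul hUm).aestronglyMeasurable)
    (Eventually.of_forall fun x => by
      apply LipschitzOnWith.of_dist_le_mul
      intro t _ s _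
      simp only [Real.coe_nnabs]
      rw [abs_of_nonneg (by positivity), Real.dist_eq, ← mul_sub, abs_mul, mul_assoc]
      gcongr
      have := D.lip.dist_le_mul (t • x) (s • x)
      rw [Real.dist_eq, dist_eq_norm, ← sub_smul, norm_smul] at this
      rw [Real.dist_eq]
      rw [Real.norm_eq_abs] at this
      linarith)
    (by
      apply Continuous.integrable_of_hasCompactSupport
      · fun_prop
      · exact hcs (R := R) fun x hx => by simp [hz x hx, hf0])
    (by
      filter_upwards [D.lip.ae_differentiableAt (μ := volume)] with x hx
      have h1 : HasDerivAt (fun t : ℝ => t • x) x 1 := by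
        simpa using (hasDerivAt_id (1:ℝ)).smul_const x
      have h2 : HasFDerivAt U (fderiv ℝ U x) ((1:ℝ) • x) := by
        rw [one_smul]; exact hx.hasFDerivAt
      exact (h2.comp_hasDerivAt (1:ℝ) h1).const_mul _)
  have e1 : ∀ i, ∫ x : EN N, x i * dd i (fun x => F (U x)) x = - ∫ x, F (U x) := by
    intro i
    have hl : LipschitzWith 1 (fun x : EN N => x i) := by
      refine LipschitzWith.of_dist_le_mul fun x y => ?_
      simp only [NNReal.coe_one, one_mul]
      exact PiLp.dist_apply_le (p := 2) x y i
    have := ibp i hl hC (hcs hHz)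
    have hd : ∀ x : EN N, dd i (fun x : EN N => x i) x = 1 := by
      intro x
      rw [dd]
      have : HasFDerivAt (fun x : EN N => x i) (EuclideanSpace.proj (𝕜 := ℝ) i) x :=
        (EuclideanSpace.proj (𝕜 := ℝ) i).hasFDerivAt
      rw [this.fderiv]; simp
    simp only [hd, one_mul] at this
    linarith
  have e2 : ∫ x, f (U x) * fderiv ℝ U x x = ∫ x : EN N, ∑ i, x i * dd i (fun x => F (U x)) x := by
    apply integral_congr_ae
    filter_upwards [D.lip.ae_differentiableAt (μ := volume)] with x hx
    have h1 := ((hF (U x)).comp_hasFDerivAt x hx.hasFDerivAt).fderiv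
    have h2 : ∀ i, dd i (fun x => F (U x)) x = f (U x) * dd i U x := by
      intro i
      rw [dd, show (fun x => F (U x)) = F ∘ U from rfl, h1]; simp [dd]
    simp only [h2]
    rw [clm_sum (fderiv ℝ U x) x, Finset.mul_sum]
    exact Finset.sum_congr rfl fun i _ => by rw [dd]; ring
  have hi : ∀ i, Integrable fun x : EN N => x i * dd i (fun x => F (U x)) x := by
    intro i
    refine integrable_bdd (C := R * C) (R := R)
      (Measurable.mul (by fun_prop) (meas_dd _ _)).aestronglyMeasurable (fun x => ?_)
      (fun x hx => by rw [dd_zero i hHz x hx, mul_zero])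
    rcases le_or_gt ‖x‖ R with hx | hx
    · rw [abs_mul]
      exact mul_le_mul ((abs_coord_le i x).trans hx) (lip_dd_le i hC x) (abs_nonneg _) D.Rpos.le
    · rw [dd_zero i hHz x hx, mul_zero, abs_zero]
      have := D.Rpos
      positivity
  have h2 := h.2
  rw [e2, integral_finsetSum _ fun i _ => hi i] at h2
  simpa [e1] using h2

end Data

lemma nonneg_deriv {k : ℝ → ℝ} {k' : ℝ} (h : HasDerivAt k k' 1) (h1 : k 1 = 0)
    (hn : ∀ᶠ t in 𝓝[>] (1:ℝ), 0 ≤ k t) : 0 ≤ k' := by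
  have h2 := (hasDerivWithinAt_iff_tendsto_slope' (s := Ioi (1:ℝ)) (by simp)).1 h.hasDerivWithinAt
  refine ge_of_tendsto h2 ?_
  filter_upwards [hn, self_mem_nhdsWithin] with t ht ht1
  rw [slope_def_field, h1, sub_zero]
  exact div_nonneg ht (by simpa using (le_of_lt ht1))

lemma deriv_pow_inv (N : ℕ) : HasDerivAt (fun t : ℝ => (t ^ N)⁻¹) (-(N:ℝ)) 1 := by
  have := (hasDerivAt_pow N (1:ℝ)).fun_inv (by simp)
  simpa using this

namespace Data

variable {N : ℕ} {Ω : Set (EN N)} {U : EN N → ℝ} {R M B : ℝ} {L : ℝ≥0}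

lemma k_deriv (D : Data Ω U R M B L) {f F : ℝ → ℝ} (hfc : Continuous f) (hf0 : f 0 = 0)
    (hF : ∀ s, HasDerivAt F (f s) s) (hF0 : F 0 = 0) {lam : ℝ}
    (hid : ∀ s, (2 - N) * (f s * s) + 2 * N * F s = 2 * lam * s ^ 2) :
    HasDerivAt (fun t : ℝ => (∫ x, f (U x) * U x) * (1 + t ^ 2 * (t ^ N)⁻¹)
      - 2 * ∫ x, f (U x) * U (t • x)) (2 * lam * ∫ x, U x ^ 2) 1 := by
  have h1 := D.D_deriv hfc hf0 hF hF0
  have h2 := ((((hasDerivAt_pow 2 (1:ℝ)).fun_mul (deriv_pow_inv N)).const_add 1).const_mul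
    (∫ x, f (U x) * U x)).fun_sub (h1.const_mul 2)
  convert! h2 using 1
  have hz := D.zero_ball D.zero
  have hUc := D.lip.continuous
  have hFc : Continuous F := continuous_iff_continuousAt.2 fun s => (hF s).continuousAt
  have i1 : Integrable fun x => f (U x) * U x := by
    apply Continuous.integrable_of_hasCompactSupport
    · fun_prop
    · exact hcs (R := R) fun x hx => by simp [hz x hx]
  have i2 : Integrable fun x => F (U x) := by
    apply Continuous.integrable_of_hasCompactSupport
    · fun_prop
    · exact hcs (R := R) fun x hx => by simp [hz x hx, hF0]
  have : 2 * lam * ∫ x, U x ^ 2 = (2 - N) * (∫ x, f (U x) * U x) + 2 * N * ∫ x, F (U x) := by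
    rw [← integral_const_mul, ← integral_const_mul, ← integral_const_mul,
      ← integral_add (i1.const_mul _) (i2.const_mul _)]
    exact integral_congr_ae (Eventually.of_forall fun x => (hid (U x)).symm)
  rw [this]
  simp
  ring

lemma k_one {f : ℝ → ℝ} : (fun t : ℝ => (∫ x, f (U x) * U x) * (1 + t ^ 2 * (t ^ N)⁻¹)
      - 2 * ∫ x, f (U x) * U (t • x)) 1 = 0 := by
  simp only [one_smul, one_pow, inv_one, mul_one]
  ring

lemma eq_zero_of_sq (D : Data Ω U R M B L) (h : ∫ x, U x ^ 2 ≤ 0) (x : EN N) : U x = 0 := by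
  by_contra hx
  have hUc := D.lip.continuous
  have hz := D.zero_ball D.zero
  have := Continuous.integral_pos_of_hasCompactSupport_nonneg_nonzero (μ := volume)
    (f := fun x => U x ^ 2) (by fun_prop)
    (hcs (R := R) fun x hx => by simp [hz x hx]) (fun x => sq_nonneg _) (x := x) (by simpa using hx)
  linarith

/-- The negative case. -/
lemma neg_case (D : Data Ω U R M B L) [NeZero N] {f F : ℝ → ℝ} (hfc : Continuous f) (hf0 : f 0 = 0)
    (hF : ∀ s, HasDerivAt F (f s) s) (hF0 : F 0 = 0) {lam : ℝ} (hlam : lam < 0)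
    (hid : ∀ s, (2 - N) * (f s * s) + 2 * N * F s = 2 * lam * s ^ 2)
    (hf : ∀ x ∈ Ω, - ∑ i, dd i (dd i U) x = f (U x))
    (hst : ∀ t : ℝ, 1 ≤ t → ∀ x, t • x ∈ Ω → x ∈ Ω) (x : EN N) : U x = 0 := by
  apply D.eq_zero_of_sq
  have := nonneg_deriv (D.k_deriv hfc hf0 hF hF0 hid) k_one (by
    filter_upwards [self_mem_nhdsWithin] with t ht
    rw [← D.k_eq hf hst (le_of_lt ht)]
    exact integral_nonneg fun x => Finset.sum_nonneg fun i _ => sq_nonneg _)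
  nlinarith

lemma k_int (D : Data Ω U R M B L)
    (hst : ∀ t : ℝ, 1 ≤ t → ∀ x, t • x ∈ Ω → x ∈ Ω) {t : ℝ} (ht : 1 ≤ t) :
    Integrable fun x => ∑ i, (dd i U x - dd i (fun x => U (t • x)) x) ^ 2 := by
  have hz := D.zero_ball D.zero
  have hz' := D.zero_ball (D.dil_zero hst ht)
  refine integrable_finsetSum _ fun i _ => ?_
  have e : (fun x => (dd i U x - dd i (fun x => U (t • x)) x) ^ 2) = fun x =>
      dd i U x * dd i U x + dd i (fun x => U (t • x)) x * dd i (fun x => U (t • x)) x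
        - 2 * (dd i U x * dd i (fun x => U (t • x)) x) := by
    ext x; ring
  rw [e]
  exact ((int_dd_mul i i D.lip D.lip hz).add
    (int_dd_mul i i (D.dil_lip t) (D.dil_lip t) hz')).sub
    ((int_dd_mul i i D.lip (D.dil_lip t) hz).const_mul 2)

/-- In the strictly star-shaped case the gradient vanishes at the boundary. -/
lemma grad_zero (D : Data Ω U R M B L) [NeZero N] {f F : ℝ → ℝ} (hfc : Continuous f)
    (hf0 : f 0 = 0) (hF : ∀ s, HasDerivAt F (f s) s) (hF0 : F 0 = 0)
    (hid : ∀ s, (2 - N) * (f s * s) + 2 * N * F s = 0)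
    (hf : ∀ x ∈ Ω, - ∑ i, dd i (dd i U) x = f (U x))
    (hss : ∀ x ∈ closure Ω, ∀ t : ℝ, 0 ≤ t → t < 1 → t • x ∈ Ω)
    (p : EN N) (hp : p ∈ frontier Ω) (i : Fin N) : Tendsto (dd i U) (𝓝[Ω] p) (𝓝 0) := by
  have hst : ∀ t : ℝ, 1 ≤ t → ∀ x, t • x ∈ Ω → x ∈ Ω := by
    intro t ht x hx
    rcases ht.eq_or_lt with h | h
    · simpa [← h] using hx
    · have := hss _ (subset_closure hx) t⁻¹ (by positivity) (inv_lt_one_of_one_lt₀ h)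
      rwa [inv_smul_smul₀ (by positivity)] at this
  have hpc : p ∈ closure Ω := frontier_subset_closure hp
  have hpΩ : p ∉ Ω := by rw [D.op.frontier_eq] at hp; exact hp.2
  obtain ⟨a, ha⟩ := D.lim p hp
  have hai : Tendsto (dd i U) (𝓝[Ω] p) (𝓝 (a (EuclideanSpace.single i 1))) :=
    ((ContinuousLinearMap.apply ℝ ℝ (EuclideanSpace.single i (1:ℝ))).continuous.tendsto a).comp ha
  by_cases h0 : a (EuclideanSpace.single i 1) = 0
  · rwa [h0] at hai
  exfalso
  set b := a (EuclideanSpace.single i 1) with hb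
  set c := |b| / 2 with hc
  have hcpos : 0 < c := by positivity
  have hev : ∀ᶠ x in 𝓝[Ω] p, c < |dd i U x| :=
    hai.abs.eventually_const_lt (by rw [hc]; linarith [abs_pos.2 h0])
  obtain ⟨r, hr, hball⟩ := Metric.mem_nhdsWithin_iff.1 hev
  set ε := min (1/4) (r / (8 * (‖p‖ + 1))) with hε
  have hε0 : 0 < ε := by positivity
  have hε1 : ε ≤ 1/4 := min_le_left _ _
  have hε2 : 2 * ε * (‖p‖ + 1) ≤ r / 4 := by
    have : ε ≤ r / (8 * (‖p‖ + 1)) := min_le_right _ _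
    rw [le_div_iff₀ (by positivity)] at this
    linarith
  have o1 : ∀ᶠ y in 𝓝 p, (1 - ε) • y ∈ Ω :=
    (continuous_const_smul (1 - ε)).continuousAt.eventually_mem
      (D.op.mem_nhds (hss p hpc (1 - ε) (by linarith) (by linarith)))
  have o2 : ∀ᶠ y in 𝓝 p, (1 + ε) • y ∈ (closure Ω)ᶜ := by
    refine (continuous_const_smul (1 + ε)).continuousAt.eventually_mem
      (isClosed_closure.isOpen_compl.mem_nhds fun h => hpΩ ?_)
    have := hss _ h (1 + ε)⁻¹ (by positivity) (inv_lt_one_of_one_lt₀ (by linarith))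
    rwa [inv_smul_smul₀ (by positivity)] at this
  obtain ⟨δ₀, hδ₀, hδb⟩ := Metric.eventually_nhds_iff_ball.1 (o1.and o2)
  set δ := min δ₀ (min 1 (r / 4)) with hδ
  have hδpos : 0 < δ := by positivity
  have hδ1 : δ ≤ 1 := (min_le_right _ _).trans (min_le_left _ _)
  have hδ2 : δ ≤ r / 4 := (min_le_right _ _).trans (min_le_right _ _)
  set K : Set (EN N) := {x | ∃ s : ℝ, 0 < s ∧ s • x ∈ Metric.ball p δ} with hK
  have hKo : IsOpen K := by
    have : K = ⋃ s ∈ Ioi (0:ℝ), (fun x : EN N => s • x) ⁻¹' Metric.ball p δ := by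
      ext x; simp [hK]
    rw [this]
    exact isOpen_biUnion fun s _ => Metric.isOpen_ball.preimage (continuous_const_smul s)
  have hKs : ∀ t : ℝ, 0 < t → ∀ x, t • x ∈ K ↔ x ∈ K := by
    intro t ht x
    constructor
    · rintro ⟨s, hs, h⟩
      exact ⟨s * t, by positivity, by rwa [mul_smul]⟩
    · rintro ⟨s, hs, h⟩
      exact ⟨s / t, by positivity, by rwa [smul_smul, div_mul_cancel₀ _ ht.ne']⟩
  set T := Ω ∩ K with hT
  have hTo : IsOpen T := D.op.inter hKo
  have hTn : T.Nonempty := by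
    refine ⟨(1 - ε) • p, hss p hpc (1 - ε) (by linarith) (by linarith), (1 - ε)⁻¹, ?_, ?_⟩
    · apply inv_pos.2; linarith
    · rw [inv_smul_smul₀ (by linarith)]; exact Metric.mem_ball_self hδpos
  have hTfin : volume T ≠ ⊤ := by
    refine ne_top_of_le_ne_top (measure_closedBall_lt_top (x := (0 : EN N)) (r := R)).ne
      (measure_mono fun x hx => ?_)
    simpa using D.bd x hx.1
  have hm : 0 < volume.real T :=
    ENNReal.toReal_pos (hTo.measure_pos volume hTn).ne' hTfin
  set m := volume.real T with hmdef
  have hS : ∀ t : ℝ, 1 ≤ t → t < 1 + ε →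
      c ^ 2 * (m * (1 - (t ^ N)⁻¹)) ≤ ∫ x, ∑ i, (dd i U x - dd i (fun x => U (t • x)) x) ^ 2 := by
    intro t ht ht2
    have ht0 : 0 < t := by linarith
    set P : Set (EN N) := (fun x : EN N => t • x) ⁻¹' T with hP
    have hPT : P ⊆ T := fun x hx => ⟨hst t ht x hx.1, (hKs t ht0 x).1 hx.2⟩
    have hPo : IsOpen P := hTo.preimage (continuous_const_smul t)
    have hPm : volume.real P = (t ^ N)⁻¹ * m := by
      rw [measureReal_def, hP, Measure.addHaar_preimage_smul volume ht0.ne', ENNReal.toReal_mul,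
        ENNReal.toReal_ofReal (abs_nonneg _), abs_of_nonneg (by positivity)]
      simp [hmdef, measureReal_def]
    have hSm : volume.real (T \ P) = m * (1 - (t ^ N)⁻¹) := by
      rw [measureReal_sdiff hPT hPo.measurableSet hTfin, hPm]; ring
    have hmeas : MeasurableSet (T \ P) := hTo.measurableSet.diff hPo.measurableSet
    have e : c ^ 2 * (m * (1 - (t ^ N)⁻¹)) = ∫ x, (T \ P).indicator (fun _ => c ^ 2) x := by
      rw [integral_indicator hmeas, setIntegral_const, hSm, smul_eq_mul]; ring
    rw [e]
    refine integral_mono_ae ?_ (D.k_int hst ht) ?_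
    · rw [integrable_indicator_iff hmeas]
      exact integrableOn_const (ne_top_of_le_ne_top hTfin (measure_mono sdiff_subset))
    · filter_upwards [ae_fderiv_zero (D.dil_lip t).continuous] with x hx
      by_cases hxS : x ∈ T \ P
      · rw [indicator_of_mem hxS]
        obtain ⟨⟨hxΩ, s, hs, hsx⟩, hxP⟩ := hxS
        have htx : t • x ∉ Ω := fun h => hxP ⟨h, (hKs t ht0 x).2 ⟨s, hs, hsx⟩⟩
        have h1 : dd i (fun x => U (t • x)) x = 0 := by
          rw [dd, hx (D.zero _ htx)]; simp
        have hsb := hδb (s • x) (Metric.ball_subset_ball (min_le_left _ _) hsx)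
        -- compare scales
        have g1 : 1 < s * (1 + ε) := by
          by_contra hcon
          push Not at hcon
          apply hsb.2
          rcases hcon.eq_or_lt with h | h
          · rw [smul_smul, mul_comm, h, one_smul]; exact subset_closure hxΩ
          · apply subset_closure
            rw [smul_smul]
            exact hss x (subset_closure hxΩ) _ (by positivity) (by linarith)
        have g2 : s * (1 - ε) < t := by
          by_contra hcon
          push Not at hcon
          apply htx
          have h3 := hst (s * (1 - ε) / t) ((one_le_div ht0).2 hcon) (t • x)
          apply h3
          rw [smul_smul, div_mul_cancel₀ _ ht0.ne', mul_comm, mul_smul]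
          exact hsb.1
        have hxb : x ∈ Metric.ball p r := by
          rw [Metric.mem_ball, dist_eq_norm]
          rw [Metric.mem_ball, dist_eq_norm] at hsx
          have n1 : ‖x‖ * s ≤ ‖p‖ + δ := by
            have : ‖s • x‖ ≤ ‖p‖ + ‖s • x - p‖ := by
              calc ‖s • x‖ = ‖p + (s • x - p)‖ := by congr 1; abel
                _ ≤ _ := norm_add_le _ _
            rw [norm_smul, Real.norm_eq_abs, abs_of_pos hs] at this
            linarith
          have n2 : ‖x - p‖ ≤ |1 - s| * ‖x‖ + ‖s • x - p‖ := by
            calc ‖x - p‖ = ‖(1 - s) • x + (s • x - p)‖ := by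
                  congr 1; rw [sub_smul, one_smul]; abel
              _ ≤ _ := (norm_add_le _ _).trans (by rw [norm_smul, Real.norm_eq_abs])
          have n3 : |1 - s| ≤ 3 * ε * s := by
            rw [abs_le]
            constructor <;> nlinarith
          have n4 : |1 - s| * ‖x‖ ≤ 3 * ε * (‖p‖ + 1) := by
            calc |1 - s| * ‖x‖ ≤ 3 * ε * s * ‖x‖ := by gcongr
              _ = 3 * ε * (‖x‖ * s) := by ring
              _ ≤ _ := by gcongr; linarith
          linarith
        have hlow : c < |dd i U x| := hball ⟨hxb, hxΩ⟩
        calc c ^ 2 ≤ |dd i U x| ^ 2 := by gcongr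
          _ = (dd i U x - dd i (fun x => U (t • x)) x) ^ 2 := by rw [h1, sub_zero, sq_abs]
          _ ≤ _ := Finset.single_le_sum
            (f := fun i => (dd i U x - dd i (fun x => U (t • x)) x) ^ 2)
            (fun j _ => sq_nonneg _) (Finset.mem_univ i)
      · rw [indicator_of_notMem hxS]
        exact Finset.sum_nonneg fun i _ => sq_nonneg _
  have hd := (D.k_deriv hfc hf0 hF hF0 (lam := 0) (by simpa using hid)).fun_sub
    (((deriv_pow_inv N).const_sub 1).const_mul (c ^ 2 * m))
  have := nonneg_deriv hd (by
    simp only [one_smul, one_pow, inv_one, mul_one]; ring) (by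
    filter_upwards [Ioo_mem_nhdsGT (show (1:ℝ) < 1 + ε by linarith)] with t ht
    rw [← D.k_eq hf hst (le_of_lt ht.1)]
    have := hS t ht.1.le ht.2
    linarith)
  have hN : (0:ℝ) < N := by exact_mod_cast Nat.pos_of_ne_zero (NeZero.ne N)
  have : 0 < c ^ 2 * m * N := by positivity
  simp at *
  linarith

end Data

lemma mul_lip {N : ℕ} {h g : EN N → ℝ} {K : ℝ≥0} {R : ℝ} (hh : ContDiff ℝ 1 h)
    (hg : LipschitzWith K g) (hz : ∀ x, R < ‖x‖ → g x = 0) :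
    ∃ C : ℝ≥0, LipschitzWith C (fun x => h x * g x) := by
  obtain ⟨Q, hQ⟩ := hg.continuous.bounded_above_of_compact_support (hcs hz)
  have hQ0 : 0 ≤ Q := (norm_nonneg _).trans (hQ 0)
  obtain ⟨C0, hC0⟩ := (isCompact_closedBall (0 : EN N) (R + 1)).exists_bound_of_continuousOn
    hh.continuous.continuousOn
  obtain ⟨C1, hC1⟩ := (isCompact_closedBall (0 : EN N) (R + 1)).exists_bound_of_continuousOn
    (hh.continuous_fderiv (by norm_num)).continuousOn
  have hC : 0 ≤ |C0| * K + Q * |C1| := by positivity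
  refine ⟨_, lip_of_zero (Ω := Metric.ball 0 (R + 1)) (H := fun x => h x * g x) Metric.isOpen_ball
    (hh.continuous.mul hg.continuous) ?_ (C := (|C0| * K + Q * |C1|).toNNReal) ?_⟩
  · intro x hx
    show h x * g x = 0
    rw [hz x, mul_zero]
    simp at hx
    linarith
  · intro x y hs
    have hx := Metric.ball_subset_closedBall (hs (left_mem_segment ℝ x y))
    rw [Real.coe_toNNReal _ hC]
    have h1 := seg_of_fderiv (Ω := Metric.ball (0 : EN N) (R + 1)) (H := h) (C := |C1|)
      (fun x _ => (hh.differentiable (by norm_num)) x)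
      (fun x hx => (hC1 x (Metric.ball_subset_closedBall hx)).trans (le_abs_self _)) x y hs
    have h2 : |g x - g y| ≤ K * ‖x - y‖ := by
      simpa [Real.dist_eq, dist_eq_norm] using hg.dist_le_mul x y
    have h3 : |h x| ≤ |C0| := (hC0 x hx).trans (le_abs_self _)
    have h4 : |g y| ≤ Q := hQ y
    have e : h x * g x - h y * g y = h x * (g x - g y) + g y * (h x - h y) := by ring
    rw [e]
    refine (abs_add_le _ _).trans ?_
    rw [abs_mul, abs_mul]
    have h5 := mul_le_mul h3 h2 (abs_nonneg _) (abs_nonneg _)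
    have h6 := mul_le_mul h4 h1 (abs_nonneg _) hQ0
    linarith

lemma dd_mul {N : ℕ} (i : Fin N) {h g : EN N → ℝ} {x : EN N} (hh : DifferentiableAt ℝ h x)
    (hg : DifferentiableAt ℝ g x) :
    dd i (fun x => h x * g x) x = dd i h x * g x + h x * dd i g x := by
  rw [dd, (hh.hasFDerivAt.fun_mul hg.hasFDerivAt).fderiv]
  simp [dd]; ring

lemma dd_coord {N : ℕ} (i z : Fin N) (x : EN N) :
    dd i (fun x : EN N => x z) x = if i = z then 1 else 0 := by
  rw [dd]
  have : HasFDerivAt (fun x : EN N => x z) (EuclideanSpace.proj (𝕜 := ℝ) z) x :=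
    (EuclideanSpace.proj (𝕜 := ℝ) z).hasFDerivAt
  rw [this.fderiv]; simp [eq_comm]

lemma dd_exp {N : ℕ} (i z : Fin N) (τ : ℝ) (x : EN N) :
    dd i (fun x : EN N => Real.exp (τ * x z)) x
      = Real.exp (τ * x z) * (τ * if i = z then 1 else 0) := by
  have h : HasFDerivAt (fun x : EN N => x z) (EuclideanSpace.proj (𝕜 := ℝ) z) x :=
    (EuclideanSpace.proj (𝕜 := ℝ) z).hasFDerivAt
  rw [dd, ((h.const_mul τ).exp).fderiv]
  simp [eq_comm]

namespace Data

variable {N : ℕ} {Ω : Set (EN N)} {U : EN N → ℝ} {R M B : ℝ} {L : ℝ≥0}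

lemma Q_lip (D : Data Ω U R M B L) (i : Fin N)
    (hg : ∀ p ∈ frontier Ω, Tendsto (dd i U) (𝓝[Ω] p) (𝓝 0)) :
    ∃ C : ℝ≥0, LipschitzWith C (Ω.indicator (dd i U)) := by
  refine ⟨_, lip_of_zero D.op ?_ (fun x hx => by simp [hx]) (C := M.toNNReal) ?_⟩
  · rw [continuous_iff_continuousAt]
    intro x
    by_cases hx : x ∈ Ω
    · have : Ω.indicator (dd i U) =ᶠ[𝓝 x] dd i U := by
        filter_upwards [D.op.mem_nhds hx] with y hy
        simp [hy]
      exact (D.dd_diff i hx).continuousAt.congr this.symm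
    · rw [ContinuousAt, indicator_of_notMem hx]
      have : 𝓝 x = 𝓝[Ω] x ⊔ 𝓝[Ωᶜ] x := by
        rw [← nhdsWithin_union, union_compl_self, nhdsWithin_univ]
      rw [this]
      refine Tendsto.sup ?_ ?_
      · by_cases hxc : x ∈ closure Ω
        · refine (hg x ?_).congr' ?_
          · rw [D.op.frontier_eq]; exact ⟨hxc, hx⟩
          · filter_upwards [self_mem_nhdsWithin] with y hy
            simp [hy]
        · have : 𝓝[Ω] x = ⊥ := by
            rwa [mem_closure_iff_nhdsWithin_neBot, not_neBot] at hxc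
          rw [this]; exact tendsto_bot
      · refine tendsto_const_nhds.congr' ?_
        filter_upwards [self_mem_nhdsWithin] with y hy
        rw [indicator_of_notMem hy]
  · intro x y hs
    rw [Real.coe_toNNReal M D.Mpos, indicator_of_mem (hs (left_mem_segment ℝ x y)),
      indicator_of_mem (hs (right_mem_segment ℝ x y))]
    exact seg_of_fderiv (fun x hx => D.dd_diff i hx) (fun x hx => D.dd_bd i hx) x y hs

/-- Unique continuation via a Carleman estimate. -/
lemma carleman (D : Data Ω U R M B L) [NeZero N]
    (hg : ∀ p ∈ frontier Ω, ∀ i, Tendsto (dd i U) (𝓝[Ω] p) (𝓝 0))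
    {V : EN N → ℝ} (hVc : Continuous V) {b : ℝ} (hVb : ∀ x, |V x| ≤ b)
    (hf : ∀ x ∈ Ω, - ∑ i, dd i (dd i U) x = V x * U x) (x : EN N) : U x = 0 := by
  have hb0 : 0 ≤ b := (abs_nonneg _).trans (hVb 0)
  obtain ⟨z⟩ : Nonempty (Fin N) := ⟨0⟩
  set Q : Fin N → EN N → ℝ := fun i => Ω.indicator (dd i U) with hQdef
  have hQl : ∀ i, ∃ C : ℝ≥0, LipschitzWith C (Q i) := fun i => D.Q_lip i (fun p hp => hg p hp i)
  have hQ0 : ∀ i x, x ∉ Ω → Q i x = 0 := fun i x hx => by simp [hQdef, hx]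
  have hQ1 : ∀ i x, x ∈ Ω → Q i x = dd i U x := fun i x hx => by simp [hQdef, hx]
  have hQd : ∀ i j x, x ∈ Ω → dd j (Q i) x = dd j (dd i U) x := fun i j x hx => by
    rw [dd, dd]
    congr 1
    apply Filter.EventuallyEq.fderiv_eq
    filter_upwards [D.op.mem_nhds hx] with y hy using hQ1 i y hy
  -- almost everywhere identities
  have ae1 : ∀ᵐ x, ∀ i, dd i U x = Q i x := by
    filter_upwards [ae_fderiv_zero D.lip.continuous] with x hx i
    by_cases hxΩ : x ∈ Ω
    · rw [hQ1 i x hxΩ]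
    · rw [hQ0 i x hxΩ, dd, hx (D.zero x hxΩ)]; simp
  have ae0 : ∀ᵐ x, x ∉ Ω → ∀ i j, dd j (Q i) x = 0 := by
    have : ∀ᵐ x, ∀ i, Q i x = 0 → fderiv ℝ (Q i) x = 0 := by
      rw [ae_all_iff]
      intro i
      obtain ⟨C, hC⟩ := hQl i
      exact ae_fderiv_zero hC.continuous
    filter_upwards [this] with x hx hxΩ i j
    rw [dd, hx i (hQ0 i x hxΩ)]; simp
  have aeD : ∀ᵐ x, ∀ i, DifferentiableAt ℝ (Q i) x := by
    rw [ae_all_iff]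
    intro i
    obtain ⟨C, hC⟩ := hQl i
    exact hC.ae_differentiableAt
  have ae2 : ∀ᵐ x, ∀ i j, dd j (Q i) x = dd i (Q j) x := by
    filter_upwards [ae0] with x hx i j
    by_cases hxΩ : x ∈ Ω
    · rw [hQd i j x hxΩ, hQd j i x hxΩ, D.symm2 i j hxΩ]
    · rw [hx hxΩ, hx hxΩ]
  have ae3 : ∀ᵐ x, ∑ i, dd i (Q i) x = - (V x * U x) := by
    filter_upwards [ae0] with x hx
    by_cases hxΩ : x ∈ Ω
    · rw [← hf x hxΩ, neg_neg]
      exact Finset.sum_congr rfl fun i _ => hQd i i x hxΩ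
    · simp [hx hxΩ, D.zero x hxΩ]
  set τ : ℝ := b * (4 * R ^ 2 + 1) / 4 + 1 with hτ
  set E : EN N → ℝ := fun x => Real.exp (τ * x z) with hE
  have hEc : ContDiff ℝ 1 E := by
    have : ContDiff ℝ 1 (fun x : EN N => x z) := (EuclideanSpace.proj (𝕜 := ℝ) z).contDiff
    exact (contDiff_const.mul this).exp
  have hEd : ∀ x, DifferentiableAt ℝ E x := fun x => hEc.differentiable (by norm_num) x
  set κ : Fin N → ℝ := fun i => if i = z then 1 else 0 with hκ
  have hEdd : ∀ i x, dd i E x = E x * (τ * κ i) := fun i x => dd_exp i z τ x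
  set G : Fin N → EN N → ℝ := fun i x => Q i x + τ * κ i * U x with hG
  have hUz := D.zero_ball D.zero
  have hQz : ∀ i x, R < ‖x‖ → Q i x = 0 := fun i => D.zero_ball (hQ0 i)
  have hGz : ∀ i x, R < ‖x‖ → G i x = 0 := fun i x hx => by simp [hG, hUz x hx, hQz i x hx]
  have hGl : ∀ i, ∃ C : ℝ≥0, LipschitzWith C (G i) := fun i => by
    obtain ⟨C, hC⟩ := hQl i
    obtain ⟨C', hC'⟩ := mul_lip (h := fun _ => τ * κ i) contDiff_const D.lip hUz
    exact ⟨_, hC.add hC'⟩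
  set W : EN N → ℝ := fun x => E x * U x with hW
  set P : Fin N → EN N → ℝ := fun i x => E x * G i x with hP
  obtain ⟨CW, hWl⟩ : ∃ C : ℝ≥0, LipschitzWith C W := mul_lip hEc D.lip hUz
  have hPl : ∀ i, ∃ C : ℝ≥0, LipschitzWith C (P i) := fun i => by
    obtain ⟨C, hC⟩ := hGl i
    exact mul_lip hEc hC (hGz i)
  have hWz : ∀ x, R < ‖x‖ → W x = 0 := fun x hx => by simp [hW, hUz x hx]
  have hPz : ∀ i x, R < ‖x‖ → P i x = 0 := fun i x hx => by simp [hP, hGz i x hx]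
  have hWc := hWl.continuous
  have hPc : ∀ i, Continuous (P i) := fun i => by
    obtain ⟨C, hC⟩ := hPl i
    exact hC.continuous
  have hWd : ∀ᵐ x, ∀ i, dd i W x = P i x := by
    filter_upwards [ae1, D.lip.ae_differentiableAt (μ := volume)] with x h1 h2 i
    rw [hW, dd_mul i (hEd x) h2, hEdd, h1 i]
    simp only [hP, hG]; ring
  have hPd : ∀ᵐ x, ∀ i j, dd j (P i) x
      = E x * (τ * κ j * (Q i x + τ * κ i * U x) + dd j (Q i) x + τ * κ i * Q j x) := by
    filter_upwards [ae1, D.lip.ae_differentiableAt (μ := volume), aeD] with x h1 h2 h3 i j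
    have hGd : HasFDerivAt (G i) (fderiv ℝ (Q i) x + (τ * κ i) • fderiv ℝ U x) x :=
      (h3 i).hasFDerivAt.add (h2.hasFDerivAt.const_mul (τ * κ i))
    have hGdd : dd j (G i) x = dd j (Q i) x + τ * κ i * Q j x := by
      rw [← h1 j, dd, hGd.fderiv]; simp [dd]
    rw [hP, dd_mul j (hEd x) hGd.differentiableAt, hEdd, hGdd]
    simp only [hG]; ring
  have hsym : ∀ᵐ x, ∀ i j, dd j (P i) x = dd i (P j) x := by
    filter_upwards [hPd, ae2] with x h1 h2 i j
    rw [h1 i j, h1 j i, h2 i j]; ring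
  have hκz : κ z = 1 := by simp [hκ]
  have hsum : ∀ᵐ x, ∑ i, dd i (P i) x = 2 * τ * P z x - τ ^ 2 * W x - V x * W x := by
    filter_upwards [hPd, ae3] with x h1 h2
    have hs1 : ∑ i, τ * κ i * (Q i x + τ * κ i * U x) = τ * (Q z x + τ * U x) := by
      rw [Finset.sum_eq_single z]
      · rw [hκz]; ring
      · intro j _ hj; simp [hκ, hj]
      · simp
    have hs2 : ∑ i, τ * κ i * Q i x = τ * Q z x := by
      rw [Finset.sum_eq_single z]
      · rw [hκz]; ring
      · intro j _ hj; simp [hκ, hj]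
      · simp
    rw [Finset.sum_congr rfl fun i _ => h1 i i, ← Finset.mul_sum, Finset.sum_add_distrib,
      Finset.sum_add_distrib, h2, hs1, hs2]
    simp only [hP, hG, hW, hκz]; ring
  -- integral identities
  have I4 : ∀ i, ∫ x, dd i (P i) x * P z x = 0 := by
    intro i
    obtain ⟨C, hC⟩ := hPl i
    obtain ⟨C', hC'⟩ := hPl z
    rw [ibp i hC hC' (hcs (hPz z))]
    have e : ∫ x, P i x * dd i (P z) x = ∫ x, P i x * dd z (P i) x := by
      apply integral_congr_ae
      filter_upwards [hsym] with x hx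
      rw [hx]
    have := ibp z hC hC (hcs (hPz i))
    have e2 : ∫ x, dd z (P i) x * P i x = ∫ x, P i x * dd z (P i) x := by
      simp_rw [mul_comm]
    rw [e]; linarith
  have I5 : ∫ x, W x * P z x = 0 := by
    have e : ∫ x, W x * P z x = ∫ x, W x * dd z W x := by
      apply integral_congr_ae
      filter_upwards [hWd] with x hx
      rw [hx]
    have := ibp z hWl hWl (hcs hWz)
    have e2 : ∫ x, dd z W x * W x = ∫ x, W x * dd z W x := by
      simp_rw [mul_comm]
    rw [e]; linarith
  have cint : ∀ h : EN N → ℝ, Continuous h → (∀ x, R < ‖x‖ → h x = 0) → Integrable h :=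
    fun h hc hz => hc.integrable_of_hasCompactSupport (hcs hz)
  have hPzc := hPc z
  have iPP : Integrable fun x => P z x ^ 2 := cint _ (by fun_prop) fun x hx => by simp [hPz z x hx]
  have iWW : Integrable fun x => W x ^ 2 := cint _ (by fun_prop) fun x hx => by simp [hWz x hx]
  have iWP : Integrable fun x => W x * P z x :=
    cint _ (by fun_prop) fun x hx => by simp [hWz x hx]
  have iVWP : Integrable fun x => V x * (W x * P z x) :=
    cint _ (by fun_prop) fun x hx => by simp [hWz x hx]
  have main1 : 2 * τ * ∫ x, P z x ^ 2 = ∫ x, V x * (W x * P z x) := by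
    have h0 : ∫ x, ∑ i, dd i (P i) x * P z x = 0 := by
      rw [integral_finsetSum]
      · simp [I4]
      · intro i _
        obtain ⟨C, hC⟩ := hPl i
        obtain ⟨q, hq⟩ := hPzc.bounded_above_of_compact_support (hcs (hPz z))
        refine integrable_bdd (C := C * q) (R := R)
          ((meas_dd _ _).mul hPzc.measurable).aestronglyMeasurable (fun x => ?_)
          (fun x hx => by rw [hPz z x hx, mul_zero])
        rw [abs_mul]
        exact mul_le_mul (lip_dd_le i hC x) (hq x) (abs_nonneg _) C.2
    have h1 : ∫ x, ∑ i, dd i (P i) x * P z x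
        = ∫ x, (2 * τ * P z x ^ 2 - τ ^ 2 * (W x * P z x) - V x * (W x * P z x)) := by
      apply integral_congr_ae
      filter_upwards [hsum] with x hx
      rw [← Finset.sum_mul, hx]; ring
    rw [h1, integral_sub (by exact (iPP.const_mul _).sub (iWP.const_mul _)) iVWP,
      integral_sub (iPP.const_mul _) (iWP.const_mul _), integral_const_mul, integral_const_mul,
      I5] at h0
    linarith
  have hxc : Continuous (fun x : EN N => x z) := by fun_prop
  have hxd : ContDiff ℝ 1 (fun x : EN N => x z) := (EuclideanSpace.proj (𝕜 := ℝ) z).contDiff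
  have ixWP : Integrable fun x : EN N => x z * (W x * P z x) :=
    cint _ (by fun_prop) fun x hx => by simp [hWz x hx]
  have main2 : ∫ x, W x ^ 2 = - 2 * ∫ x : EN N, x z * (W x * P z x) := by
    obtain ⟨C, hC⟩ := mul_lip hxd hWl hWz
    have h := ibp z hC hWl (hcs hWz)
    have e1 : ∫ x : EN N, dd z (fun x => x z * W x) x * W x
        = ∫ x : EN N, (W x ^ 2 + x z * (W x * P z x)) := by
      apply integral_congr_ae
      filter_upwards [hWd, hWl.ae_differentiableAt (μ := volume)] with x h1 h2
      rw [dd_mul z (hxd.differentiable (by norm_num) x) h2, dd_coord, h1]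
      simp; ring
    have e2 : ∫ x : EN N, x z * W x * dd z W x = ∫ x : EN N, x z * (W x * P z x) := by
      apply integral_congr_ae
      filter_upwards [hWd] with x h1
      rw [h1]; ring
    rw [e1, e2, integral_add iWW ixWP] at h
    linarith
  have main3 : ∫ x, W x ^ 2 ≤ 4 * R ^ 2 * ∫ x, P z x ^ 2 := by
    have : - 2 * ∫ x : EN N, x z * (W x * P z x)
        ≤ ∫ x, ((1/2) * W x ^ 2 + 2 * R ^ 2 * P z x ^ 2) := by
      rw [← integral_const_mul]
      refine integral_mono (ixWP.const_mul _) ((iWW.const_mul _).add (iPP.const_mul _)) fun x => ?_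
      simp only
      rcases le_or_gt ‖x‖ R with hx | hx
      · have h1 : |x z| ≤ R := (abs_coord_le z x).trans hx
        have h2 : (x z) ^ 2 ≤ R ^ 2 := sq_le_sq' (abs_le.1 h1).1 (abs_le.1 h1).2
        have h3 : (x z) ^ 2 * P z x ^ 2 ≤ R ^ 2 * P z x ^ 2 := by gcongr
        nlinarith [sq_nonneg (W x + 2 * (x z * P z x))]
      · rw [hWz x hx, hPz z x hx]; simp
    rw [integral_add (iWW.const_mul _) (iPP.const_mul _), integral_const_mul, integral_const_mul,
      ← main2] at this
    linarith
  have main4 : ∫ x, V x * (W x * P z x) ≤ b / 2 * (∫ x, W x ^ 2) + b / 2 * ∫ x, P z x ^ 2 := by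
    rw [← integral_const_mul, ← integral_const_mul,
      ← integral_add (iWW.const_mul _) (iPP.const_mul _)]
    refine integral_mono iVWP ((iWW.const_mul _).add (iPP.const_mul _)) fun x => ?_
    simp only
    have h1 : V x * (W x * P z x) ≤ b * |W x * P z x| := by
      refine (le_abs_self _).trans ?_
      rw [abs_mul]
      exact mul_le_mul_of_nonneg_right (hVb x) (abs_nonneg _)
    have h2 : |W x * P z x| ≤ (W x ^ 2 + P z x ^ 2) / 2 := by
      rw [abs_le]
      constructor <;> nlinarith [sq_nonneg (W x + P z x), sq_nonneg (W x - P z x)]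
    nlinarith
  have hPn : 0 ≤ ∫ x, P z x ^ 2 := integral_nonneg fun x => sq_nonneg _
  have hP0 : ∫ x, P z x ^ 2 ≤ 0 := by
    have h5 : 2 * τ * ∫ x, P z x ^ 2
        ≤ b / 2 * (4 * R ^ 2 * ∫ x, P z x ^ 2) + b / 2 * ∫ x, P z x ^ 2 := by
      rw [main1]
      refine main4.trans ?_
      gcongr
    rw [hτ] at h5
    nlinarith
  have hW0 : ∫ x, W x ^ 2 ≤ 0 := by
    refine main3.trans ?_
    have : ∫ x, P z x ^ 2 = 0 := le_antisymm hP0 hPn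
    rw [this]; simp
  by_contra hx
  have hWx : W x ≠ 0 := mul_ne_zero (Real.exp_pos _).ne' hx
  have := Continuous.integral_pos_of_hasCompactSupport_nonneg_nonzero (μ := volume)
    (f := fun x => W x ^ 2) (by fun_prop)
    (hcs (R := R) fun x hx => by simp [hWz x hx]) (fun x => sq_nonneg _) (x := x)
    (by simpa using hWx)
  linarith

end Data

end Poho

/-- Pohozaev nonexistence: on a bounded domain star-shaped with respect to the
origin, any solution of `-Δu = λu + |u|^{2*-2}u` with zero boundary values is
trivial, provided `λ < 0`, or `λ = 0` and `Ω` is strictly star-shaped. -/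
theorem pohozaev_nonexistence (N : ℕ) (hN : 3 ≤ N)
    (Ω : Set (EuclideanSpace ℝ (Fin N))) (hΩo : IsOpen Ω)
    (hΩb : Bornology.IsBounded Ω)
    (hstar : StarConvex ℝ 0 Ω)
    (lam : ℝ) (hlam : lam ≤ 0)
    (u : EuclideanSpace ℝ (Fin N) → ℝ)
    (hureg : ContDiffOn ℝ 2 u (closure Ω))
    (hueq : ∀ x ∈ Ω, -lap u x = lam * u x + |u x| ^ ((4 : ℝ) / ((N : ℝ) - 2)) * u x)
    (hubd : ∀ x ∈ frontier Ω, u x = 0)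
    (hcase : lam < 0 ∨
      (lam = 0 ∧ ∀ x ∈ closure Ω, ∀ t : ℝ, 0 ≤ t → t < 1 → t • x ∈ Ω)) :
    ∀ x ∈ Ω, u x = 0 := by
  haveI : NeZero N := ⟨by omega⟩
  obtain ⟨R, M, B, L, D⟩ := Poho.exists_data hΩo hΩb hureg hubd
  have hN3 : (3 : ℝ) ≤ N := by exact_mod_cast hN
  have hN2 : (0 : ℝ) < (N : ℝ) - 2 := by linarith
  set p : ℝ := (4 : ℝ) / ((N : ℝ) - 2) with hp
  have hp0 : 0 < p := by positivity
  have hpN : p * ((N : ℝ) - 2) = 4 := by rw [hp]; field_simp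
  set U := Ω.indicator u with hU
  have hUu : ∀ x ∈ Ω, U x = u x := fun x hx => Set.indicator_of_mem hx u
  have hlapU : ∀ x ∈ Ω, - ∑ i, Poho.dd i (Poho.dd i U) x = lam * U x + |U x| ^ p * U x := by
    intro x hx
    have he : U =ᶠ[nhds x] u := by
      filter_upwards [hΩo.mem_nhds hx] with y hy using hUu y hy
    rw [hUu x hx, ← hueq x hx]
    congr 1
    unfold lap Poho.dd
    refine Finset.sum_congr rfl fun i _ => ?_
    have h2 : (fun y => fderiv ℝ U y (EuclideanSpace.single i 1))
        =ᶠ[nhds x] fun y => fderiv ℝ u y (EuclideanSpace.single i 1) := by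
      filter_upwards [he.fderiv (𝕜 := ℝ)] with y hy
      rw [hy]
    rw [h2.fderiv_eq]
  have habs : ∀ s : ℝ, |s| ^ p * s * s = |s| ^ (p + 2) := by
    intro s
    rw [Real.rpow_add_of_nonneg (abs_nonneg s) hp0.le (by norm_num)]
    have : |s| ^ (2 : ℝ) = s * s := by
      rw [show (2 : ℝ) = ((2 : ℕ) : ℝ) by norm_num, Real.rpow_natCast, sq_abs, sq]
    rw [this]; ring
  have hfc : Continuous fun s : ℝ => lam * s + |s| ^ p * s := by
    have : Continuous fun s : ℝ => |s| ^ p :=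
      continuous_abs.rpow_const fun _ => Or.inr hp0.le
    fun_prop
  have hf0 : (fun s : ℝ => lam * s + |s| ^ p * s) 0 = 0 := by simp
  have hF : ∀ s : ℝ, HasDerivAt (fun s : ℝ => lam * s ^ 2 / 2 + |s| ^ (p + 2) / (p + 2))
      ((fun s : ℝ => lam * s + |s| ^ p * s) s) s := by
    intro s
    have h1 := ((hasDerivAt_pow 2 s).const_mul lam).div_const 2
    have h2 := (hasDerivAt_abs_rpow s (p := p + 2) (by linarith)).div_const (p + 2)
    refine (h1.add h2).congr_deriv ?_
    have : p + 2 - 2 = p := by ring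
    rw [this]
    have : p + 2 ≠ 0 := by positivity
    field_simp
    push_cast
    ring
  have hF0 : (fun s : ℝ => lam * s ^ 2 / 2 + |s| ^ (p + 2) / (p + 2)) 0 = 0 := by
    have : p + 2 ≠ 0 := by positivity
    simp [Real.zero_rpow this]
  have hid : ∀ s : ℝ, (2 - (N : ℝ)) * ((fun s : ℝ => lam * s + |s| ^ p * s) s * s)
      + 2 * N * (fun s : ℝ => lam * s ^ 2 / 2 + |s| ^ (p + 2) / (p + 2)) s
      = 2 * lam * s ^ 2 := by
    intro s
    have h1 : p + 2 ≠ 0 := by positivity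
    have h3 : (2 * N : ℝ) / (p + 2) = N - 2 := by
      rw [div_eq_iff h1]; linarith
    have h4 : 2 * (N : ℝ) * (lam * s ^ 2 / 2 + |s| ^ (p + 2) / (p + 2))
        = N * lam * s ^ 2 + (2 * N : ℝ) / (p + 2) * |s| ^ (p + 2) := by ring
    simp only
    rw [h4, h3, ← habs s]
    ring
  intro x hx
  rw [← hUu x hx]
  rcases hcase with hneg | ⟨h0, hss⟩
  · refine D.neg_case hfc hf0 hF hF0 hneg hid hlapU ?_ x
    intro t ht y hy
    have h := hstar.smul_mem hy (t := t⁻¹) (by positivity) (inv_le_one_of_one_le₀ ht)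
    rwa [smul_smul, inv_mul_cancel₀ (by positivity), one_smul] at h
  · have hg := D.grad_zero hfc hf0 hF hF0 (fun s => by rw [hid s, h0]; ring) hlapU hss
    refine D.carleman (V := fun x => |U x| ^ p) (b := B ^ p) hg ?_ ?_ ?_ x
    · exact D.lip.continuous.abs.rpow_const fun _ => Or.inr hp0.le
    · intro y
      rw [abs_of_nonneg (by positivity)]
      exact Real.rpow_le_rpow (abs_nonneg _) (D.ub y) hp0.le
    · intro y hy
      rw [hlapU y hy, h0]; ring
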